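/- arXiv:1911.04654 — 2 statements merged into one kernel-verified Lean document; each statement's English description precedes it below -/
import Mathlib

section
/- Let α, β ∈ (0, π/2) and t ∈ (0, π/2) be real numbers, and define g := sin(α)·sin(β)·cos(t) + cos(α)·cos(β) (the cosine of the angle γ between the item and the query induced by the dihedral angle t). If (cos(β)/(sin(α)·sin(β)))·(1/(2 − cos(α)) − cos(α)) ≤ cos(t) ≤ (cos(β)/(sin(α)·sin(β)))·(1/cos(α) − cos(α)), then g > 0 and |g − cos(β)| ≤ (1 − cos(α))·g; that is, the relative inner product error |cos(γ) − cos(β)|/cos(γ) is at most the angular error 1 − cos(α). -/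
open Real

theorem stmt0 (α β t : ℝ)
    (hα : α ∈ Set.Ioo 0 (π / 2)) (hβ : β ∈ Set.Ioo 0 (π / 2))
    (ht : t ∈ Set.Ioo 0 (π / 2))
    (hlo : (cos β / (sin α * sin β)) * (1 / (2 - cos α) - cos α) ≤ cos t)
    (hhi : cos t ≤ (cos β / (sin α * sin β)) * (1 / cos α - cos α)) :
    0 < sin α * sin β * cos t + cos α * cos β ∧
      |(sin α * sin β * cos t + cos α * cos β) - cos β| ≤
        (1 - cos α) * (sin α * sin β * cos t + cos α * cos β) := by
  have hsα : 0 < sin α := sin_pos_of_pos_of_lt_pi hα.1 (by linarith [hα.2, pi_pos])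
  have hsβ : 0 < sin β := sin_pos_of_pos_of_lt_pi hβ.1 (by linarith [hβ.2, pi_pos])
  have hcα : 0 < cos α := cos_pos_of_mem_Ioo ⟨by linarith [hα.1, pi_pos], hα.2⟩
  have hcβ : 0 < cos β := cos_pos_of_mem_Ioo ⟨by linarith [hβ.1, pi_pos], hβ.2⟩
  have hct : 0 < cos t := cos_pos_of_mem_Ioo ⟨by linarith [ht.1, pi_pos], ht.2⟩
  have hs : 0 < sin α * sin β := mul_pos hsα hsβ
  have hd : 0 < 2 - cos α := by linarith [cos_le_one α]
  rw [div_mul_eq_mul_div, div_le_iff₀ hs] at hlo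
  rw [div_mul_eq_mul_div, le_div_iff₀ hs] at hhi
  have hlower : cos β / (2 - cos α) ≤ sin α * sin β * cos t + cos α * cos β := by
    rw [div_eq_mul_one_div]
    linarith
  have hupper : sin α * sin β * cos t + cos α * cos β ≤ cos β / cos α := by
    rw [div_eq_mul_one_div]
    linarith
  rw [div_le_iff₀ hd] at hlower
  rw [le_div_iff₀ hcα] at hupper
  refine ⟨by positivity, abs_le.mpr ⟨?_, ?_⟩⟩ <;> linarith
end

section
/- Let E be a real inner product space, let w, u, v ∈ E be unit vectors with ⟨w, u⟩ = 0 and ⟨w, v⟩ = 0, let α, β ∈ (0, π/2) and r, s > 0 be real numbers, and define x̄ := r • w, x := r • (cos(α) • w + sin(α) • u), and q := s • (cos(β) • w + sin(β) • v). If (cos(β)/(sin(α)·sin(β)))·(1/(2 − cos(α)) − cos(α)) ≤ ⟨u, v⟩ ≤ (cos(β)/(sin(α)·sin(β)))·(1/cos(α) − cos(α)), then ⟨q, x⟩ > 0 and |⟨q, x⟩ − ⟨q, x̄⟩| ≤ (1 − cos(α))·⟨q, x⟩. -/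
open Real RealInnerProductSpace

theorem stmt1 {E : Type*} [NormedAddCommGroup E] [InnerProductSpace ℝ E]
    (w u v : E) (hw : ‖w‖ = 1) (hu : ‖u‖ = 1) (hv : ‖v‖ = 1)
    (hwu : ⟪w, u⟫ = 0) (hwv : ⟪w, v⟫ = 0)
    (α β r s : ℝ)
    (hα : α ∈ Set.Ioo 0 (π / 2)) (hβ : β ∈ Set.Ioo 0 (π / 2))
    (hr : 0 < r) (hs : 0 < s)
    (hlo : (cos β / (sin α * sin β)) * (1 / (2 - cos α) - cos α) ≤ ⟪u, v⟫)
    (hhi : ⟪u, v⟫ ≤ (cos β / (sin α * sin β)) * (1 / cos α - cos α)) :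
    0 < ⟪s • (cos β • w + sin β • v), r • (cos α • w + sin α • u)⟫ ∧
      |⟪s • (cos β • w + sin β • v), r • (cos α • w + sin α • u)⟫ -
          ⟪s • (cos β • w + sin β • v), r • w⟫| ≤
        (1 - cos α) * ⟪s • (cos β • w + sin β • v), r • (cos α • w + sin α • u)⟫ := by
  have hca : 0 < cos α := cos_pos_of_mem_Ioo ⟨by linarith [hα.1, pi_pos], hα.2⟩
  have hcb : 0 < cos β := cos_pos_of_mem_Ioo ⟨by linarith [hβ.1, pi_pos], hβ.2⟩
  have hsa : 0 < sin α := sin_pos_of_pos_of_lt_pi hα.1 (by linarith [hα.2, pi_pos])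
  have hsb : 0 < sin β := sin_pos_of_pos_of_lt_pi hβ.1 (by linarith [hβ.2, pi_pos])
  have hsab : 0 < sin α * sin β := mul_pos hsa hsb
  have hd : 0 < 2 - cos α := by linarith [cos_le_one α]
  have hx : ⟪s • (cos β • w + sin β • v), r • (cos α • w + sin α • u)⟫ =
      r * s * (cos α * cos β + sin α * sin β * ⟪u, v⟫) := by
    simp only [inner_add_left, inner_add_right, real_inner_smul_left, real_inner_smul_right,
      real_inner_self_eq_norm_sq, hw, hwu, real_inner_comm w v, real_inner_comm u v, hwv]
    ring
  have hy : ⟪s • (cos β • w + sin β • v), r • w⟫ = r * s * cos β := by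
    simp only [inner_add_left, real_inner_smul_left, real_inner_smul_right,
      real_inner_self_eq_norm_sq, hw, real_inner_comm w v, hwv]
    ring
  rw [hx, hy]
  rw [div_mul_eq_mul_div, div_le_iff₀ hsab] at hlo
  rw [div_mul_eq_mul_div, le_div_iff₀ hsab] at hhi
  set A := cos α * cos β + sin α * sin β * ⟪u, v⟫ with hA
  have hlower : cos β / (2 - cos α) ≤ A := by
    rw [hA, div_eq_mul_one_div]
    linarith
  have hupper : A ≤ cos β / cos α := by
    rw [hA, div_eq_mul_one_div]
    linarith
  have hApos : 0 < A := (div_pos hcb hd).trans_le hlower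
  have hrs : 0 < r * s := mul_pos hr hs
  rw [div_le_iff₀ hd] at hlower
  rw [le_div_iff₀ hca] at hupper
  refine ⟨mul_pos hrs hApos, ?_⟩
  rw [← mul_sub, abs_mul, abs_of_pos hrs, mul_left_comm]
  exact mul_le_mul_of_nonneg_left (abs_le.2 ⟨by linarith, by linarith⟩) hrs.le
end
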